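/- arXiv:1702.02308 — 2 statements merged into one kernel-verified Lean document; each statement's English description precedes it below -/
import Mathlib

section
/- Let 𝒯=(V,ℰ) be a leafless, locally finite rooted directed tree and let q ≥ 1 be a real number. Then there exists a unique bounded linear operator S_{λ,q} on ℓ²(V) satisfying S_{λ,q} e_v = Σ_{u∈Chi(v)} λ_{u,q} e_u for every v ∈ V, and the operator norm of S_{λ,q} equals √q. -/
open scoped ENNReal InnerProductSpace
open ContinuousLinearMap

noncomputable section

/-- A (countably infinite) rooted directed tree. -/
structure DirTree (V : Type) where
  edge : V → V → Prop
  not_self : ∀ v, ¬ edge v v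
  no_circuit : ∀ v, ¬ Relation.TransGen edge v v
  connected : ∀ u v : V, Relation.ReflTransGen (fun a b => edge a b ∨ edge b a) u v
  uniq_parent : ∀ {u w v : V}, edge u v → edge w v → u = w
  root : V
  root_no_parent : ∀ u, ¬ edge u root
  root_uniq : ∀ v, (∀ u, ¬ edge u v) → v = root

namespace DirTree

variable {V : Type} (T : DirTree V)

/-- The set of children of a vertex. -/
def chi (v : V) : Set V := {u | T.edge v u}

/-- Leafless: every vertex has a child. -/
def Leafless : Prop := ∀ v : V, ∃ u, T.edge v u

/-- Locally finite: every vertex has finitely many children. -/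
def LocFin : Prop := ∀ v : V, (T.chi v).Finite

/-- The finset of children of a vertex (locally finite case). -/
def chiFin (hT : T.LocFin) (v : V) : Finset V := (hT v).toFinset

/-- Iterated child sets `Chi^⟨n⟩(W)`. -/
def chiIter (T : DirTree V) : ℕ → Set V → Set V
  | 0, W => W
  | n + 1, W => {u | ∃ v ∈ chiIter T n W, T.edge v u}

/-- The depth of a vertex: the unique `n` with `v ∈ Chi^⟨n⟩(root)`. -/
def depth (v : V) : ℕ := sInf {n | v ∈ T.chiIter n {T.root}}

/-- The parent map (junk value at the root). -/
def par (v : V) : V :=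
  letI := Classical.propDecidable (∃ u, T.edge u v)
  if h : ∃ u, T.edge u v then h.choose else v

end DirTree

/-- `ℓ²(V)`. -/
abbrev l2 (V : Type) := lp (fun _ : V => ℂ) 2

/-- The standard orthonormal basis vector `e_v` of `ℓ²(V)`. -/
def evec {V : Type} (v : V) : l2 V :=
  letI := Classical.decEq V
  lp.single 2 v 1

/-- The Pochhammer symbol `(x)_k = x (x+1) ⋯ (x+k-1)`. -/
def poch (x : ℝ) (k : ℕ) : ℝ := ∏ i ∈ Finset.range k, (x + i)

namespace DirTree

variable {V : Type} (T : DirTree V)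

/-- The weight `λ_{u,q}` (for any child `u` of `v`). -/
def wt (hT : T.LocFin) (q : ℝ) (v : V) : ℝ :=
  Real.sqrt (((T.depth v : ℝ) + q) / ((T.depth v : ℝ) + 1)) /
    Real.sqrt ((T.chiFin hT v).card)

/-- `S` is the Dirichlet shift with parameter `q` on `ℓ²(V)`:
`S e_v = ∑_{u ∈ Chi(v)} λ_{u,q} e_u`. -/
def IsDirichletShift (hT : T.LocFin) (q : ℝ) (S : l2 V →L[ℂ] l2 V) : Prop :=
  ∀ v : V, S (evec v) = ∑ u ∈ T.chiFin hT v, ((T.wt hT q v : ℝ) : ℂ) • evec u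

end DirTree

/-- The Cauchy dual `S (S*S)⁻¹` of a left-invertible operator. -/
def cauchyDual {V : Type} (S : l2 V →L[ℂ] l2 V) : l2 V →L[ℂ] l2 V :=
  S * Ring.inverse (ContinuousLinearMap.adjoint S * S)

theorem evec_eq_single {V : Type} [DecidableEq V] (v : V) :
    evec v = lp.single (E := fun _ : V => ℂ) 2 v 1 := by
  unfold evec
  congr!

theorem orthonormal_evec {V : Type} : Orthonormal ℂ (evec : V → l2 V) := by
  classical
  rw [orthonormal_iff_ite]
  intro v w
  rw [evec_eq_single, evec_eq_single, lp.inner_single_left, lp.single_apply]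
  by_cases h : v = w
  · subst h; simp
  · simp [h]

/-- Bounded operators on `ℓ²(V)` are determined by their values on the standard basis. -/
theorem l2_clm_ext {V : Type} {A B : l2 V →L[ℂ] l2 V} (h : ∀ v, A (evec v) = B (evec v)) :
    A = B := by
  classical
  refine lp.ext_continuousLinearMap (by simp) fun v => ?_
  ext1
  simpa [evec_eq_single] using h v

namespace DirTree

variable {V : Type} (T : DirTree V)

theorem mem_chiFin {hT : T.LocFin} {v u : V} : u ∈ T.chiFin hT v ↔ T.edge v u := by
  simp [chiFin, chi]

theorem card_chiFin_pos (hL : T.Leafless) (hT : T.LocFin) (v : V) :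
    0 < (T.chiFin hT v).card := by
  obtain ⟨u, hu⟩ := hL v
  exact Finset.card_pos.2 ⟨u, T.mem_chiFin.2 hu⟩

theorem depth_root : T.depth T.root = 0 :=
  Nat.sInf_eq_zero.2 (Or.inl rfl)

/-- The normalized indicator function of the set of children of `v`. -/
def childVec (hT : T.LocFin) (v : V) : l2 V :=
  (((Real.sqrt (T.chiFin hT v).card)⁻¹ : ℝ) : ℂ) • ∑ u ∈ T.chiFin hT v, evec u

theorem orthonormal_childVec (hL : T.Leafless) (hT : T.LocFin) :
    Orthonormal ℂ (T.childVec hT) := by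
  classical
  rw [orthonormal_iff_ite]
  intro v w
  simp only [childVec, inner_smul_left, inner_smul_right, sum_inner, inner_sum,
    orthonormal_iff_ite.1 orthonormal_evec, Finset.sum_ite_eq']
  split_ifs with h
  · subst h
    have hc : (0 : ℝ) < (T.chiFin hT v).card := by exact_mod_cast T.card_chiFin_pos hL hT v
    have hs0 := (Real.sqrt_pos.2 hc).ne'
    rw [Finset.sum_congr rfl fun u hu => by rw [if_pos hu], Complex.conj_ofReal]
    simp only [Finset.sum_const, nsmul_eq_mul, mul_one]
    norm_cast
    field_simp
    rw [Real.sq_sqrt hc.le]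
  · rw [Finset.sum_eq_zero, mul_zero]
    intro u hu
    rw [if_neg, mul_zero]
    intro hu'
    exact h (T.uniq_parent (T.mem_chiFin.1 hu') (T.mem_chiFin.1 hu))

/-- The norm `√((n_v + q) / (n_v + 1))` of the image of `e_v` under the Dirichlet shift. -/
def shiftNorm (q : ℝ) (v : V) : ℝ :=
  Real.sqrt (((T.depth v : ℝ) + q) / ((T.depth v : ℝ) + 1))

theorem shiftNorm_nonneg (q : ℝ) (v : V) : 0 ≤ T.shiftNorm q v := Real.sqrt_nonneg _

theorem shiftNorm_root (q : ℝ) : T.shiftNorm q T.root = Real.sqrt q := by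
  simp [shiftNorm, depth_root]

theorem shiftNorm_le {q : ℝ} (hq : 1 ≤ q) (v : V) : T.shiftNorm q v ≤ Real.sqrt q := by
  apply Real.sqrt_le_sqrt
  have hd : (0 : ℝ) ≤ T.depth v := Nat.cast_nonneg _
  rw [div_le_iff₀ (by positivity)]
  nlinarith

theorem isDirichletShift_iff {hT : T.LocFin} {q : ℝ} {S : l2 V →L[ℂ] l2 V} :
    T.IsDirichletShift hT q S ↔
      ∀ v, S (evec v) = (T.shiftNorm q v : ℂ) • T.childVec hT v := by
  refine forall_congr' fun v => ?_
  rw [childVec, smul_smul, Finset.smul_sum, wt, shiftNorm, div_eq_mul_inv, Complex.ofReal_mul]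

theorem exists_isDirichletShift_norm_le (hL : T.Leafless) (hT : T.LocFin) {q : ℝ} (hq : 1 ≤ q) :
    ∃ S : l2 V →L[ℂ] l2 V, T.IsDirichletShift hT q S ∧ ‖S‖ ≤ Real.sqrt q := by
  classical
  let W := (T.orthonormal_childVec hL hT).orthogonalFamily.linearIsometry
  have hD (v : V) : ‖(T.shiftNorm q v : ℂ) • ContinuousLinearMap.id ℂ ℂ‖ ≤ Real.sqrt q := by
    simpa [norm_smul, abs_of_nonneg (T.shiftNorm_nonneg q v)] using T.shiftNorm_le hq v
  let D : l2 V →L[ℂ] l2 V := lp.mapCLM 2 _ (Real.sqrt_nonneg q) hD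
  have hDe (v : V) : D (evec v) = (T.shiftNorm q v : ℂ) • evec v := by
    ext w
    rw [evec_eq_single]
    by_cases h : w = v
    · subst h; simp [D, -Complex.coe_smul]
    · simp [D, h, -Complex.coe_smul]
  have hWe (v : V) : W (evec v) = T.childVec hT v := by
    rw [evec_eq_single, OrthogonalFamily.linearIsometry_apply_single]
    simp
  refine ⟨W.toContinuousLinearMap.comp D, T.isDirichletShift_iff.2 fun v => ?_, ?_⟩
  · simp [hDe, hWe, -Complex.coe_smul]
  · refine ContinuousLinearMap.opNorm_le_bound _ (Real.sqrt_nonneg q) fun f => ?_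
    simpa using D.le_of_opNorm_le (lp.norm_mapCLM_le 2 _ (Real.sqrt_nonneg q) hD) f

theorem IsDirichletShift.unique {hT : T.LocFin} {q : ℝ} {S S' : l2 V →L[ℂ] l2 V}
    (hS : T.IsDirichletShift hT q S) (hS' : T.IsDirichletShift hT q S') : S = S' :=
  l2_clm_ext fun v => (hS v).trans (hS' v).symm

theorem IsDirichletShift.sqrt_le_norm (hL : T.Leafless) {hT : T.LocFin} {q : ℝ}
    {S : l2 V →L[ℂ] l2 V} (hS : T.IsDirichletShift hT q S) : Real.sqrt q ≤ ‖S‖ := by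
  have h := S.le_opNorm (evec T.root)
  rw [T.isDirichletShift_iff.1 hS, norm_smul, orthonormal_evec.1,
    (T.orthonormal_childVec hL hT).1, T.shiftNorm_root] at h
  simpa [abs_of_nonneg (Real.sqrt_nonneg q)] using h

end DirTree

theorem stmt_0 {V : Type} [Countable V] [Infinite V] (T : DirTree V)
    (hL : T.Leafless) (hT : T.LocFin) (q : ℝ) (hq : 1 ≤ q) :
    (∃! S : l2 V →L[ℂ] l2 V, T.IsDirichletShift hT q S) ∧
      ∀ S : l2 V →L[ℂ] l2 V, T.IsDirichletShift hT q S → ‖S‖ = Real.sqrt q := by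
  obtain ⟨S₀, hS₀, hle⟩ := T.exists_isDirichletShift_norm_le hL hT hq
  refine ⟨⟨S₀, hS₀, fun S hS => hS.unique T hS₀⟩, fun S hS => ?_⟩
  exact le_antisymm (hS.unique T hS₀ ▸ hle) (hS.sqrt_le_norm T hL)

end
end

section
/- Let A be a bounded linear operator on a complex Hilbert space H such that A*A is invertible, and let A' = A(A*A)^{-1} be its Cauchy dual. Then [A*,A]A = −A*A([A'*,A']A)A*A, where [T*,T] := T*T − TT* denotes the self-commutator. -/
open scoped ENNReal InnerProductSpace
open ContinuousLinearMap

noncomputable section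

/-- In a star ring, if `p = star a * a` is a unit and `b = a * p⁻¹`, then the self-commutators of
`a` and `b` satisfy `[star a, a] * a = -(p * ([star b, b] * a) * p)`. -/
theorem selfCommutator_mul_eq_neg_of_isUnit {R : Type*} [Ring R] [StarRing R] {a b : R}
    (ha : IsUnit (star a * a)) (hb : b = a * Ring.inverse (star a * a)) :
    (star a * a - a * star a) * a =
      -((star a * a) * ((star b * b - b * star b) * a) * (star a * a)) := by
  have hsa : star (Ring.inverse (star a * a)) = Ring.inverse (star a * a) := by
    rw [← Ring.inverse_star, star_mul, star_star]
  have hpq := Ring.mul_inverse_cancel _ ha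
  have hqp := Ring.inverse_mul_cancel _ ha
  have hstar : star b = Ring.inverse (star a * a) * star a := by
    rw [hb, star_mul, hsa]
  have hbb : star b * b = Ring.inverse (star a * a) := by
    rw [hstar, hb, mul_assoc, ← mul_assoc (star a), hpq, mul_one]
  have hba : b * star b * a = b := by
    rw [hstar, mul_assoc, mul_assoc, hqp, mul_one]
  have hbp : b * (star a * a) = a := by
    rw [hb, mul_assoc, hqp, mul_one]
  rw [sub_mul, sub_mul, hbb, hba, mul_sub, sub_mul, ← mul_assoc (star a * a), hpq, one_mul,
    mul_assoc (star a * a) b, hbp, neg_sub, mul_assoc a (star a) a]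

theorem stmt_11 {H : Type} [NormedAddCommGroup H] [InnerProductSpace ℂ H]
    [CompleteSpace H] (A : H →L[ℂ] H)
    (hA : IsUnit (ContinuousLinearMap.adjoint A * A))
    (A' : H →L[ℂ] H) (hA' : A' = A * Ring.inverse (ContinuousLinearMap.adjoint A * A)) :
    (ContinuousLinearMap.adjoint A * A - A * ContinuousLinearMap.adjoint A) * A =
      -((ContinuousLinearMap.adjoint A * A) *
        ((ContinuousLinearMap.adjoint A' * A' - A' * ContinuousLinearMap.adjoint A') * A) *
        (ContinuousLinearMap.adjoint A * A)) := by
  exact selfCommutator_mul_eq_neg_of_isUnit hA hA'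

end
end
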